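/- Let N ≥ 2, let e_1, …, e_N be the standard basis of ℝ^N, let y = (1/N)(e_1 + ⋯ + e_N), and let Σ = {x ∈ ℝ^N : x_1 + ⋯ + x_N = 1 and |x − y| = √((N−1)/N)}, an (N−2)-dimensional sphere of radius √((N−1)/N) in the hyperplane {x_1 + ⋯ + x_N = 1}. Then for every polynomial p on ℝ^N of degree at most 2, (1/|Σ|) ∫_Σ p dS = (1/N) Σ_{i=1}^N p(e_i), where dS is the standard surface measure on Σ and |Σ| its total measure. -/

import Mathlib

open MeasureTheory Real Filter Topology ENNReal

noncomputable section

/-- The barycenter `y = (1/N)(e_1 + ⋯ + e_N)` of the standard basis vectors of `ℝ^N`. -/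
def centerPoint (N : ℕ) : EuclideanSpace ℝ (Fin N) :=
  (WithLp.equiv 2 (Fin N → ℝ)).symm (fun _ => (N : ℝ)⁻¹)

/-- The sphere `Σ = {x ∈ ℝ^N : x_1 + ⋯ + x_N = 1, |x - y| = √((N-1)/N)}`, the
`(N-2)`-dimensional sphere of radius `√((N-1)/N)` centered at `y` inside the affine
hyperplane `H = {x : x_1 + ⋯ + x_N = 1}`. -/
def simplexSphere (N : ℕ) : Set (EuclideanSpace ℝ (Fin N)) :=
  {x | (∑ i, x i) = 1 ∧ dist x (centerPoint N) = Real.sqrt (((N : ℝ) - 1) / N)}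

section Sphere

open scoped Pointwise

variable {E : Type*} [NormedAddCommGroup E] [InnerProductSpace ℝ E]

theorem mem_image_stereoInvFunAux {v x : E} (hv : ‖v‖ = 1) (hx : ‖x‖ = 1)
    (h : inner ℝ v x ≤ 0) :
    x ∈ (fun w : (ℝ ∙ v)ᗮ => stereoInvFunAux v (w : E)) '' Metric.closedBall 0 2 := by
  have hxv : x ≠ v := by
    rintro rfl
    rw [real_inner_self_eq_norm_sq, hx] at h
    norm_num at h
  refine ⟨stereoToFun v x, ?_, ?_⟩
  · rw [mem_closedBall_zero_iff, stereoToFun_apply, norm_smul, innerSL_apply_apply,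
      Real.norm_of_nonneg (div_nonneg zero_le_two (by linarith))]
    have h1 : ‖(ℝ ∙ v)ᗮ.orthogonalProjectionOnto x‖ ≤ 1 :=
      ((ℝ ∙ v)ᗮ.norm_orthogonalProjectionOnto_apply_le x).trans_eq hx
    have h2 : 2 / (1 - inner ℝ v x) ≤ 2 := by
      rw [div_le_iff₀ (by linarith)]
      linarith
    calc _ ≤ 2 * (1 : ℝ) := mul_le_mul h2 h1 (norm_nonneg _) zero_le_two
      _ = 2 := mul_one 2
  · exact congrArg Subtype.val
      (stereo_left_inv hv (x := ⟨x, mem_sphere_zero_iff_norm.2 hx⟩) hxv)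

theorem finrank_orthogonal_singleton_eq {d : ℕ} (h : Module.finrank ℝ E = d + 1) {v : E} (hv : ‖v‖ = 1) :
    Module.finrank ℝ (ℝ ∙ v)ᗮ = d := by
  have : Fact (Module.finrank ℝ E = d + 1) := ⟨h⟩
  exact Submodule.finrank_orthogonal_span_singleton (norm_ne_zero_iff.1 (by simp [hv]))

theorem sphere_eq_smul_unitSphere {r : ℝ} (hr : 0 < r) :
    Metric.sphere (0 : E) r = r • Metric.sphere (0 : E) 1 := by
  rw [smul_sphere' hr.ne', smul_zero, Real.norm_of_nonneg hr.le, mul_one]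

variable [FiniteDimensional ℝ E] [MeasurableSpace E] [BorelSpace E] {d : ℕ}

theorem hausdorffMeasure_image_stereoInvFunAux_lt_top (h : Module.finrank ℝ E = d + 1)
    {v : E} (hv : ‖v‖ = 1) :
    μH[(d : ℝ)] ((fun w : (ℝ ∙ v)ᗮ => stereoInvFunAux v (w : E)) '' Metric.closedBall 0 2) < ∞ := by
  have hf : ContDiff ℝ 1 (fun w : (ℝ ∙ v)ᗮ => stereoInvFunAux v (w : E)) :=
    contDiff_stereoInvFunAux.comp (ℝ ∙ v)ᗮ.subtypeL.contDiff
  have hc : IsCompact (Metric.closedBall (0 : (ℝ ∙ v)ᗮ) 2) := isCompact_closedBall _ _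
  obtain ⟨K, hK⟩ := (hf.locallyLipschitz.locallyLipschitzOn
    (s := Metric.closedBall (0 : (ℝ ∙ v)ᗮ) 2)).exists_lipschitzOnWith_of_compact hc
  refine (hK.hausdorffMeasure_image_le d.cast_nonneg).trans_lt (ENNReal.mul_lt_top ?_ ?_)
  · exact ENNReal.rpow_lt_top_of_nonneg d.cast_nonneg ENNReal.coe_ne_top
  · have := finrank_orthogonal_singleton_eq h hv
    rw [← this]
    exact hc.measure_lt_top

theorem hausdorffMeasure_unitSphere_lt_top (h : Module.finrank ℝ E = d + 1) :
    μH[(d : ℝ)] (Metric.sphere (0 : E) 1) < ∞ := by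
  have : Nontrivial E := Module.nontrivial_of_finrank_pos (R := ℝ) (by omega)
  obtain ⟨v, hv⟩ := exists_norm_eq E zero_le_one
  have hv' : ‖-v‖ = 1 := by rwa [norm_neg]
  refine (measure_mono fun x hx => ?_).trans_lt (measure_union_lt_top
    (hausdorffMeasure_image_stereoInvFunAux_lt_top h hv)
    (hausdorffMeasure_image_stereoInvFunAux_lt_top h hv'))
  rw [mem_sphere_zero_iff_norm] at hx
  rcases le_total (inner ℝ v x) 0 with h0 | h0
  · exact Or.inl (mem_image_stereoInvFunAux hv hx h0)
  · exact Or.inr (mem_image_stereoInvFunAux hv' hx (by rw [inner_neg_left]; linarith))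

theorem hausdorffMeasure_unitSphere_pos (h : Module.finrank ℝ E = d + 1) :
    0 < μH[(d : ℝ)] (Metric.sphere (0 : E) 1) := by
  have : Nontrivial E := Module.nontrivial_of_finrank_pos (R := ℝ) (by omega)
  obtain ⟨v, hv⟩ := exists_norm_eq E zero_le_one
  have hsub : Metric.ball (0 : (ℝ ∙ v)ᗮ) 1 ⊆
      (ℝ ∙ v)ᗮ.orthogonalProjectionOnto '' Metric.sphere (0 : E) 1 := by
    intro w hw
    rw [mem_ball_zero_iff] at hw
    have hw2 : 0 ≤ 1 - ‖w‖ ^ 2 := by nlinarith [norm_nonneg w]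
    have hvw : inner ℝ (w : E) v = 0 :=
      Submodule.mem_orthogonal_singleton_iff_inner_left.1 w.2
    refine ⟨w + √(1 - ‖w‖ ^ 2) • v, ?_, ?_⟩
    · rw [mem_sphere_zero_iff_norm, ← sq_eq_sq₀ (norm_nonneg _) zero_le_one, norm_add_sq_real,
        inner_smul_right, hvw, norm_smul, hv, Real.norm_of_nonneg (Real.sqrt_nonneg _),
        mul_one, Real.sq_sqrt hw2, Submodule.norm_coe]
      ring
    · rw [map_add, map_smul, Submodule.orthogonalProjectionOnto_mem_subspace_eq_self,
        Submodule.orthogonalProjectionOnto_eq_zero_iff.2 ?_, smul_zero, add_zero]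
      exact Submodule.le_orthogonal_orthogonal _ (Submodule.mem_span_singleton_self v)
  have hpos : 0 < μH[(d : ℝ)] (Metric.ball (0 : (ℝ ∙ v)ᗮ) 1) := by
    have := finrank_orthogonal_singleton_eq h hv
    rw [← this]
    exact Metric.measure_ball_pos _ _ one_pos
  refine hpos.trans_le ((measure_mono hsub).trans ?_)
  exact hausdorffMeasure_orthogonalProjectionOnto_le _ d _ d.cast_nonneg

theorem hausdorffMeasure_sphere_lt_top (h : Module.finrank ℝ E = d + 1) {r : ℝ} (hr : 0 < r) :
    μH[(d : ℝ)] (Metric.sphere (0 : E) r) < ∞ := by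
  rw [sphere_eq_smul_unitSphere hr, Measure.hausdorffMeasure_smul₀ d.cast_nonneg hr.ne']
  exact ENNReal.mul_lt_top ENNReal.coe_lt_top (hausdorffMeasure_unitSphere_lt_top h)

theorem hausdorffMeasure_sphere_pos (h : Module.finrank ℝ E = d + 1) {r : ℝ} (hr : 0 < r) :
    0 < μH[(d : ℝ)] (Metric.sphere (0 : E) r) := by
  rw [sphere_eq_smul_unitSphere hr, Measure.hausdorffMeasure_smul₀ d.cast_nonneg hr.ne']
  refine ENNReal.mul_pos ?_ (hausdorffMeasure_unitSphere_pos h).ne'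
  simp [hr.ne']

end Sphere

section SimplexSphere

variable {N : ℕ}

@[simp]
theorem centerPoint_apply (i : Fin N) : centerPoint N i = (N : ℝ)⁻¹ := rfl

theorem inner_centerPoint_right (x : EuclideanSpace ℝ (Fin N)) :
    inner ℝ x (centerPoint N) = (N : ℝ)⁻¹ * ∑ i, x i := by
  simp [PiLp.inner_apply, Finset.mul_sum]

theorem sum_centerPoint (hN : N ≠ 0) : ∑ i, centerPoint N i = 1 := by
  simp [hN]

theorem norm_centerPoint_sq (hN : N ≠ 0) : ‖centerPoint N‖ ^ 2 = (N : ℝ)⁻¹ := by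
  rw [← real_inner_self_eq_norm_sq, inner_centerPoint_right, sum_centerPoint hN, mul_one]

theorem radius_pos (hN : 2 ≤ N) : 0 < √(((N : ℝ) - 1) / N) := by
  have : (2 : ℝ) ≤ N := by exact_mod_cast hN
  exact Real.sqrt_pos.2 (div_pos (by linarith) (by linarith))

theorem simplexSphere_eq_image (hN : N ≠ 0) :
    simplexSphere N = (fun z : (ℝ ∙ centerPoint N)ᗮ => (z : EuclideanSpace ℝ (Fin N)) +
      centerPoint N) '' Metric.sphere 0 √(((N : ℝ) - 1) / N) := by
  have key (z : EuclideanSpace ℝ (Fin N)) : z ∈ (ℝ ∙ centerPoint N)ᗮ ↔ ∑ i, z i = 0 := by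
    rw [Submodule.mem_orthogonal_singleton_iff_inner_left, inner_centerPoint_right]
    simp [hN]
  ext x
  constructor
  · rintro ⟨h1, h2⟩
    refine ⟨⟨x - centerPoint N, (key _).2 ?_⟩, ?_, sub_add_cancel _ _⟩
    · simp only [PiLp.sub_apply, Finset.sum_sub_distrib, sum_centerPoint hN, h1, sub_self]
    · rw [mem_sphere_zero_iff_norm, Submodule.coe_norm, ← dist_eq_norm, h2]
  · rintro ⟨z, hz, rfl⟩
    rw [mem_sphere_zero_iff_norm] at hz
    refine ⟨?_, ?_⟩
    · simp only [PiLp.add_apply, Finset.sum_add_distrib, sum_centerPoint hN, (key _).1 z.2,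
        zero_add]
    · rw [dist_eq_norm, add_sub_cancel_right, Submodule.norm_coe, hz]

theorem hausdorffMeasure_simplexSphere (hN : 2 ≤ N) :
    μH[(N : ℝ) - 2] (simplexSphere N) =
      μH[((N - 2 : ℕ) : ℝ)] (Metric.sphere (0 : (ℝ ∙ centerPoint N)ᗮ) √(((N : ℝ) - 1) / N)) := by
  rw [simplexSphere_eq_image (by omega), Nat.cast_sub hN, Nat.cast_ofNat]
  refine Isometry.hausdorffMeasure_image ?_ (Or.inl ?_) _
  · exact (isometry_add_right _).comp isometry_subtype_coe
  · have : (2 : ℝ) ≤ N := by exact_mod_cast hN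
    linarith

theorem finrank_orthogonal_centerPoint (hN : 2 ≤ N) :
    Module.finrank ℝ (ℝ ∙ centerPoint N)ᗮ = N - 2 + 1 := by
  have : Fact (Module.finrank ℝ (EuclideanSpace ℝ (Fin N)) = N - 2 + 1 + 1) :=
    ⟨by rw [finrank_euclideanSpace_fin]; omega⟩
  refine Submodule.finrank_orthogonal_span_singleton fun h => ?_
  have := norm_centerPoint_sq (N := N) (by omega)
  rw [h, norm_zero] at this
  have hN' : (N : ℝ) ≠ 0 := by positivity
  exact inv_ne_zero hN' (by rw [← this]; norm_num)

theorem hausdorffMeasure_simplexSphere_lt_top (hN : 2 ≤ N) :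
    μH[(N : ℝ) - 2] (simplexSphere N) < ∞ := by
  rw [hausdorffMeasure_simplexSphere hN]
  exact hausdorffMeasure_sphere_lt_top (finrank_orthogonal_centerPoint hN) (radius_pos hN)

theorem hausdorffMeasure_simplexSphere_pos (hN : 2 ≤ N) :
    0 < μH[(N : ℝ) - 2] (simplexSphere N) := by
  rw [hausdorffMeasure_simplexSphere hN]
  exact hausdorffMeasure_sphere_pos (finrank_orthogonal_centerPoint hN) (radius_pos hN)

theorem isCompact_simplexSphere (hN : N ≠ 0) : IsCompact (simplexSphere N) := by
  rw [simplexSphere_eq_image hN]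
  exact (isCompact_sphere _ _).image (by fun_prop)

theorem sum_sq_eq_one_of_mem_simplexSphere (hN : 2 ≤ N) {x : EuclideanSpace ℝ (Fin N)}
    (hx : x ∈ simplexSphere N) : ∑ i, x i ^ 2 = 1 := by
  obtain ⟨h1, h2⟩ := hx
  have hN' : (2 : ℝ) ≤ N := by exact_mod_cast hN
  have h3 : ‖x - centerPoint N‖ ^ 2 = ((N : ℝ) - 1) / N := by
    rw [← dist_eq_norm, h2, Real.sq_sqrt (div_nonneg (by linarith) (by linarith))]
  rw [norm_sub_sq_real, inner_centerPoint_right, norm_centerPoint_sq (by omega), h1,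
    EuclideanSpace.real_norm_sq_eq] at h3
  have h4 : ((N : ℝ) - 1) / N = 1 - (N : ℝ)⁻¹ := by field_simp
  linarith

theorem piLpCongrLeft_preimage_simplexSphere (σ : Equiv.Perm (Fin N)) :
    LinearIsometryEquiv.piLpCongrLeft 2 ℝ ℝ σ ⁻¹' simplexSphere N = simplexSphere N := by
  have hc : LinearIsometryEquiv.piLpCongrLeft 2 ℝ ℝ σ (centerPoint N) = centerPoint N := rfl
  ext x
  have h1 : ∑ i, LinearIsometryEquiv.piLpCongrLeft 2 ℝ ℝ σ x i = ∑ i, x i :=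
    Equiv.sum_comp σ.symm fun i => x i
  have h2 : dist (LinearIsometryEquiv.piLpCongrLeft 2 ℝ ℝ σ x) (centerPoint N) =
      dist x (centerPoint N) := by
    conv_lhs => rw [← hc]
    exact LinearIsometryEquiv.dist_map _ _ _
  simp only [simplexSphere, Set.mem_preimage, Set.mem_ofPred_eq, h1, h2]

theorem setIntegral_simplexSphere_comp_perm (σ : Equiv.Perm (Fin N))
    (f : (Fin N → ℝ) → ℝ) (s : ℝ) :
    ∫ x in simplexSphere N, f (fun i => x (σ i)) ∂μH[s] =
      ∫ x in simplexSphere N, f (fun i => x i) ∂μH[s] := by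
  let e := LinearIsometryEquiv.piLpCongrLeft 2 ℝ ℝ σ.symm
  have h := (e.toIsometryEquiv.measurePreserving_hausdorffMeasure s).setIntegral_preimage_emb
    e.toHomeomorph.measurableEmbedding (fun x => f fun i => x i) (simplexSphere N)
  rw [← h]
  exact congrArg (fun t => ∫ x in t, f (fun i => x (σ i)) ∂μH[s])
    (piLpCongrLeft_preimage_simplexSphere σ.symm).symm

theorem integrableOn_simplexSphere (hN : 2 ≤ N) {f : EuclideanSpace ℝ (Fin N) → ℝ}
    (hf : Continuous f) : IntegrableOn f (simplexSphere N) μH[(N : ℝ) - 2] := by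
  have hc := isCompact_simplexSphere (N := N) (by omega)
  obtain ⟨C, hC⟩ := hc.exists_bound_of_continuousOn hf.continuousOn
  exact Measure.integrableOn_of_bounded (hausdorffMeasure_simplexSphere_lt_top hN).ne
    hf.aestronglyMeasurable ((ae_restrict_iff' hc.measurableSet).2 (ae_of_all _ hC))

theorem setIntegral_simplexSphere_of_forall_eq (hN : 2 ≤ N) {f : EuclideanSpace ℝ (Fin N) → ℝ}
    {c : ℝ} (h : ∀ x ∈ simplexSphere N, f x = c) :
    ∫ x in simplexSphere N, f x ∂μH[(N : ℝ) - 2] =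
      μH[(N : ℝ) - 2].real (simplexSphere N) * c := by
  rw [setIntegral_congr_fun (isCompact_simplexSphere (by omega)).measurableSet h,
    setIntegral_const, smul_eq_mul]

theorem setIntegral_simplexSphere_pow (hN : 2 ≤ N) (k : ℕ) {c : ℝ}
    (h : ∀ x ∈ simplexSphere N, ∑ i, x i ^ k = c) (i : Fin N) :
    ∫ x in simplexSphere N, x i ^ k ∂μH[(N : ℝ) - 2] =
      μH[(N : ℝ) - 2].real (simplexSphere N) * (c / N) := by
  have hsum := setIntegral_simplexSphere_of_forall_eq hN h
  rw [integral_finsetSum _ fun j _ => integrableOn_simplexSphere hN (by fun_prop)] at hsum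
  have hperm (j : Fin N) : ∫ x in simplexSphere N, x j ^ k ∂μH[(N : ℝ) - 2] =
      ∫ x in simplexSphere N, x i ^ k ∂μH[(N : ℝ) - 2] := by
    have := setIntegral_simplexSphere_comp_perm (Equiv.swap i j) (fun y => y i ^ k) ((N : ℝ) - 2)
    simpa using this
  rw [Finset.sum_congr rfl fun j _ => hperm j, Finset.sum_const, Finset.card_univ,
    Fintype.card_fin, nsmul_eq_mul] at hsum
  have hN' : (N : ℝ) ≠ 0 := by positivity
  field_simp
  linarith

theorem setIntegral_simplexSphere_mul_of_ne (hN : 2 ≤ N) {i j : Fin N} (hij : i ≠ j) :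
    ∫ x in simplexSphere N, x i * x j ∂μH[(N : ℝ) - 2] = 0 := by
  have hzero (x) (hx : x ∈ simplexSphere N) :
      ∑ k ∈ Finset.univ.erase i, x i * x k = x i - x i ^ 2 := by
    rw [Finset.sum_erase_eq_sub (Finset.mem_univ i), ← Finset.mul_sum, hx.1]
    ring
  have hsum : ∫ x in simplexSphere N, ∑ k ∈ Finset.univ.erase i, x i * x k ∂μH[(N : ℝ) - 2] =
      0 := by
    rw [setIntegral_congr_fun (isCompact_simplexSphere (by omega)).measurableSet hzero,
      integral_sub (integrableOn_simplexSphere hN (by fun_prop))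
        (integrableOn_simplexSphere hN (by fun_prop)),
      setIntegral_simplexSphere_pow hN 2 (fun x hx => sum_sq_eq_one_of_mem_simplexSphere hN hx)]
    have := setIntegral_simplexSphere_pow hN 1 (c := 1) (fun x hx => by simpa using hx.1) i
    simp only [pow_one] at this
    rw [this, sub_self]
  rw [integral_finsetSum _ fun j _ => integrableOn_simplexSphere hN (by fun_prop)] at hsum
  have hperm (k) (hk : k ∈ Finset.univ.erase i) :
      ∫ x in simplexSphere N, x i * x k ∂μH[(N : ℝ) - 2] =
        ∫ x in simplexSphere N, x i * x j ∂μH[(N : ℝ) - 2] := by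
    have := setIntegral_simplexSphere_comp_perm (Equiv.swap j k) (fun y => y i * y j)
      ((N : ℝ) - 2)
    simp only [Equiv.swap_apply_left] at this
    rwa [Equiv.swap_apply_of_ne_of_ne hij (Finset.ne_of_mem_erase hk).symm] at this
  rw [Finset.sum_congr rfl hperm, Finset.sum_const, nsmul_eq_mul, mul_eq_zero] at hsum
  refine hsum.resolve_left (Nat.cast_ne_zero.2 (Finset.card_ne_zero.2 ⟨j, ?_⟩))
  exact Finset.mem_erase.2 ⟨hij.symm, Finset.mem_univ j⟩

theorem Finsupp.exists_eq_single_add_of_ne_zero {ι : Type*} {m : ι →₀ ℕ} (hm : m ≠ 0) :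
    ∃ i m', m = Finsupp.single i 1 + m' := by
  obtain ⟨i, hi⟩ := Finsupp.ne_iff.1 hm
  refine ⟨i, m - Finsupp.single i 1, (add_tsub_cancel_of_le ?_).symm⟩
  exact Finsupp.single_le_iff.2 (Nat.one_le_iff_ne_zero.2 hi)

theorem setIntegral_simplexSphere_monomial (hN : 2 ≤ N) {m : Fin N →₀ ℕ} (hm : m.degree ≤ 2) :
    ∫ x in simplexSphere N, MvPolynomial.eval (fun j => x j) (MvPolynomial.monomial m (1 : ℝ))
        ∂μH[(N : ℝ) - 2] =
      μH[(N : ℝ) - 2].real (simplexSphere N) * ((∑ i, MvPolynomial.eval (Pi.single i (1 : ℝ))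
        (MvPolynomial.monomial m (1 : ℝ))) / N) := by
  have hN' : (N : ℝ) ≠ 0 := by positivity
  by_cases h0 : m = 0
  · subst h0
    rw [setIntegral_simplexSphere_of_forall_eq hN (c := 1) (by simp)]
    simp [hN']
  obtain ⟨i, m, rfl⟩ := Finsupp.exists_eq_single_add_of_ne_zero h0
  rw [map_add, Finsupp.degree_single] at hm
  by_cases h1 : m = 0
  · subst h1
    have hmon : MvPolynomial.monomial (Finsupp.single i 1 + 0) (1 : ℝ) = MvPolynomial.X i := by
      rw [add_zero, MvPolynomial.X]
    simpa [hmon, Pi.single_apply, -add_zero] using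
      setIntegral_simplexSphere_pow hN 1 (c := 1) (fun x hx => by simpa using hx.1) i
  obtain ⟨j, m, rfl⟩ := Finsupp.exists_eq_single_add_of_ne_zero h1
  rw [map_add, Finsupp.degree_single] at hm
  obtain rfl : m = 0 := (Finsupp.degree_eq_zero_iff m).1 (by omega)
  have hmon : MvPolynomial.monomial (Finsupp.single i 1 + (Finsupp.single j 1 + 0)) (1 : ℝ) =
      MvPolynomial.X i * MvPolynomial.X j := by
    rw [add_zero, MvPolynomial.X, MvPolynomial.X, MvPolynomial.monomial_mul, one_mul]
  simp only [hmon, map_mul, MvPolynomial.eval_X]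
  by_cases hij : i = j
  · subst hij
    simpa [Pi.single_apply, ← sq] using
      setIntegral_simplexSphere_pow hN 2 (fun x hx => sum_sq_eq_one_of_mem_simplexSphere hN hx) i
  · rw [setIntegral_simplexSphere_mul_of_ne hN hij]
    simp [Pi.single_apply, hij]

theorem setIntegral_simplexSphere_eval (hN : 2 ≤ N) {p : MvPolynomial (Fin N) ℝ}
    (hp : p.totalDegree ≤ 2) :
    ∫ x in simplexSphere N, MvPolynomial.eval (fun j => x j) p ∂μH[(N : ℝ) - 2] =
      μH[(N : ℝ) - 2].real (simplexSphere N) *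
        ((∑ i, MvPolynomial.eval (Pi.single i (1 : ℝ)) p) / N) := by
  have heval (y : Fin N → ℝ) : MvPolynomial.eval y p =
      ∑ m ∈ p.support, p.coeff m * MvPolynomial.eval y (MvPolynomial.monomial m (1 : ℝ)) := by
    rw [MvPolynomial.eval_eq]
    simp only [MvPolynomial.eval_monomial, Finsupp.prod, one_mul]
  have hcont (q : MvPolynomial (Fin N) ℝ) :
      Continuous fun x : EuclideanSpace ℝ (Fin N) => MvPolynomial.eval (fun j => x j) q :=
    (MvPolynomial.continuous_eval q).comp (by fun_prop)
  simp_rw [heval]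
  rw [integral_finsetSum _ fun m _ =>
      integrableOn_simplexSphere hN ((hcont _).const_mul _), Finset.sum_comm,
    Finset.sum_div, Finset.mul_sum]
  refine Finset.sum_congr rfl fun m hm => ?_
  rw [integral_const_mul, setIntegral_simplexSphere_monomial hN
    ((MvPolynomial.le_totalDegree hm).trans hp), ← Finset.mul_sum]
  ring

end SimplexSphere

/-- **Lemma 3.2.**  For every polynomial `p` on `ℝ^N` (`N ≥ 2`) of degree at most `2`,
`(1/|Σ|) ∫_Σ p dS = (1/N) Σ_{i=1}^N p(e_i)`, where `dS` is the standard `(N-2)`-dimensional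
surface measure on `Σ` (the `(N-2)`-dimensional Hausdorff measure of `ℝ^N` restricted
to `Σ`). -/
theorem average_over_simplexSphere (N : ℕ) (hN : 2 ≤ N)
    (p : MvPolynomial (Fin N) ℝ) (hp : p.totalDegree ≤ 2) :
    (1 / (μH[((N : ℝ) - 2)] (simplexSphere N)).toReal) *
      (∫ x in simplexSphere N, MvPolynomial.eval (fun j => x j) p ∂(μH[((N : ℝ) - 2)])) =
    (1 / (N : ℝ)) * ∑ i, MvPolynomial.eval (Pi.single i (1 : ℝ)) p := by
  have hne : (μH[((N : ℝ) - 2)] (simplexSphere N)).toReal ≠ 0 :=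
    (ENNReal.toReal_pos (hausdorffMeasure_simplexSphere_pos hN).ne'
      (hausdorffMeasure_simplexSphere_lt_top hN).ne).ne'
  rw [setIntegral_simplexSphere_eval hN hp, Measure.real, ← mul_assoc, one_div_mul_cancel hne,
    one_mul, div_eq_inv_mul, one_div]
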